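/- arXiv:1304.0283 — 5 statements merged into one kernel-verified Lean document; each statement's English description precedes it below -/
import Mathlib

section
/- Let ρ be a two-qubit state (a 4×4 complex positive semidefinite matrix with trace 1), and let Φ be a product of local unital quantum operations given in Kraus form: there are finite families {A_i} and {B_j} of 2×2 complex matrices satisfying Σ_i A_i† A_i = I₂, Σ_i A_i A_i† = I₂, Σ_j B_j† B_j = I₂, Σ_j B_j B_j† = I₂, and Φ(ρ) := Σ_{i,j} (A_i ⊗ B_j) ρ (A_i ⊗ B_j)†. Then F_RSP(Φ(ρ)) ≤ F_RSP(ρ), i.e., the RSP-fidelity of a two-qubit state does not increase under local unital operations. -/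
open Matrix Kronecker ComplexOrder

noncomputable section

def pauli : Fin 3 → Matrix (Fin 2) (Fin 2) ℂ :=
  ![!![0, 1; 1, 0], !![0, -Complex.I; Complex.I, 0], !![1, 0; 0, -1]]

def corr (ρ : Matrix (Fin 2 × Fin 2) (Fin 2 × Fin 2) ℂ) : Matrix (Fin 3) (Fin 3) ℝ :=
  Matrix.of fun k l => (Matrix.trace (ρ * (pauli k ⊗ₖ pauli l))).re

def lambdaMax (M : Matrix (Fin 3) (Fin 3) ℝ) : ℝ :=
  sSup {x : ℝ | ∃ v : Fin 3 → ℝ, v ≠ 0 ∧ M.mulVec v = x • v}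

def Frsp (ρ : Matrix (Fin 2 × Fin 2) (Fin 2 × Fin 2) ℂ) : ℝ :=
  (1 / 2) * (Matrix.trace ((corr ρ)ᵀ * corr ρ) - lambdaMax ((corr ρ)ᵀ * corr ρ))

def damp (p : ℝ) : Fin 2 → Matrix (Fin 2) (Fin 2) ℂ :=
  ![!![1, 0; 0, (Real.sqrt (1 - p) : ℂ)], !![0, (Real.sqrt p : ℂ); 0, 0]]

def Phi (p : ℝ) (ρ : Matrix (Fin 2 × Fin 2) (Fin 2 × Fin 2) ℂ) :
    Matrix (Fin 2 × Fin 2) (Fin 2 × Fin 2) ℂ :=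
  ∑ i : Fin 2, ∑ j : Fin 2, (damp p i ⊗ₖ damp p j) * ρ * (damp p i ⊗ₖ damp p j)ᴴ

def bellDiag (c₁ c₂ c₃ : ℝ) : Matrix (Fin 2 × Fin 2) (Fin 2 × Fin 2) ℂ :=
  (1 / 4 : ℂ) • (1 + (c₁ : ℂ) • (pauli 0 ⊗ₖ pauli 0) + (c₂ : ℂ) • (pauli 1 ⊗ₖ pauli 1)
    + (c₃ : ℂ) • (pauli 2 ⊗ₖ pauli 2))

def bloch (ρ : Matrix (Fin 2 × Fin 2) (Fin 2 × Fin 2) ℂ) : Fin 3 → ℝ :=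
  fun k => (Matrix.trace (ρ * (pauli k ⊗ₖ (1 : Matrix (Fin 2) (Fin 2) ℂ)))).re

def Dg (ρ : Matrix (Fin 2 × Fin 2) (Fin 2 × Fin 2) ℂ) : ℝ :=
  (1 / 2) * ((∑ k, bloch ρ k ^ 2) + Matrix.trace (corr ρ * (corr ρ)ᵀ)
    - lambdaMax (Matrix.vecMulVec (bloch ρ) (bloch ρ) + corr ρ * (corr ρ)ᵀ))

section Qubit

/-- The traceless Hermitian matrix with Bloch vector `v`. -/
def pauliVec (v : Fin 3 → ℝ) : Matrix (Fin 2) (Fin 2) ℂ :=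
  ∑ k, (v k : ℂ) • pauli k

lemma pauliVec_eq (v : Fin 3 → ℝ) :
    pauliVec v = !![(v 2 : ℂ), v 0 - v 1 * Complex.I; v 0 + v 1 * Complex.I, -(v 2 : ℂ)] := by
  ext i j
  fin_cases i <;> fin_cases j <;>
    simp [pauliVec, pauli, Fin.sum_univ_three, Matrix.add_apply, sub_eq_add_neg]

lemma pauliVec_conjTranspose (v : Fin 3 → ℝ) : (pauliVec v)ᴴ = pauliVec v := by
  rw [pauliVec_eq]
  ext i j
  fin_cases i <;> fin_cases j <;> simp [Matrix.conjTranspose_apply, sub_eq_add_neg]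

lemma pauliVec_mul_self (v : Fin 3 → ℝ) :
    pauliVec v * pauliVec v = ((v ⬝ᵥ v : ℝ) : ℂ) • (1 : Matrix (Fin 2) (Fin 2) ℂ) := by
  rw [pauliVec_eq]
  have h := Complex.I_sq
  ext i j
  fin_cases i <;> fin_cases j <;>
    simp [Matrix.mul_apply, Fin.sum_univ_three, dotProduct] <;>
      first | ring1 | linear_combination (-(v 1 : ℂ) ^ 2) * h

lemma trace_pauliVec (v : Fin 3 → ℝ) : (pauliVec v).trace = 0 := by
  rw [pauliVec_eq]; simp [Matrix.trace_fin_two]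

lemma pauliVec_single (k : Fin 3) : pauliVec (Pi.single k 1) = pauli k := by
  simp [pauliVec, Pi.single_apply]

lemma sum_smul_pauliVec (v : Fin 3 → ℝ) (M : Matrix (Fin 3) (Fin 3) ℝ) :
    ∑ k, (v k : ℂ) • pauliVec (M k) = pauliVec (v ᵥ* M) := by
  simp only [pauliVec, Finset.smul_sum, smul_smul, vecMul, dotProduct, Complex.ofReal_sum,
    Finset.sum_smul, Complex.ofReal_mul]
  exact Finset.sum_comm

lemma exists_eq_pauliVec {Y : Matrix (Fin 2) (Fin 2) ℂ} (hY : Yᴴ = Y) (ht : Y.trace = 0) :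
    ∃ w, Y = pauliVec w := by
  refine ⟨![(Y 0 1).re, -(Y 0 1).im, (Y 0 0).re], ?_⟩
  have h00 := congrFun (congrFun hY 0) 0
  have h10 := congrFun (congrFun hY 1) 0
  rw [Matrix.trace_fin_two] at ht
  rw [pauliVec_eq]
  simp only [conjTranspose_apply, Complex.ext_iff, RCLike.star_def, Complex.conj_re,
    Complex.conj_im] at h00 h10
  simp only [Complex.ext_iff, Complex.add_re, Complex.add_im, Complex.zero_re,
    Complex.zero_im] at ht
  ext i j
  fin_cases i <;> fin_cases j <;> simp [Complex.ext_iff] <;>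
    first | linarith | (constructor <;> linarith)

variable {m : ℕ} {A : Fin m → Matrix (Fin 2) (Fin 2) ℂ}

/-- The dual of a unital channel acts linearly on Bloch vectors. -/
lemma exists_bloch_matrix (hA' : ∑ i, A i * (A i)ᴴ = 1) :
    ∃ M : Matrix (Fin 3) (Fin 3) ℝ, ∀ k, ∑ i, (A i)ᴴ * pauli k * A i = pauliVec (M k) := by
  have h : ∀ k, ∃ w, ∑ i, (A i)ᴴ * pauli k * A i = pauliVec w := by
    intro k
    rw [← pauliVec_single]
    apply exists_eq_pauliVec
    · simp [conjTranspose_sum, conjTranspose_mul, pauliVec_conjTranspose, Matrix.mul_assoc]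
    · have : ∀ i, ((A i)ᴴ * pauliVec (Pi.single k 1) * A i).trace
          = (pauliVec (Pi.single k 1) * (A i * (A i)ᴴ)).trace := fun i => by
        rw [Matrix.mul_assoc, Matrix.trace_mul_comm, Matrix.mul_assoc]
      rw [Matrix.trace_sum, Finset.sum_congr rfl fun i _ => this i, ← Matrix.trace_sum,
        ← Matrix.mul_sum, hA', Matrix.mul_one, trace_pauliVec]
  choose M hM using h
  exact ⟨M, hM⟩

/-- Kadison–Schwarz inequality for Bloch vectors. -/
lemma dotProduct_vecMul_le (hA : ∑ i, (A i)ᴴ * A i = 1) {M : Matrix (Fin 3) (Fin 3) ℝ}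
    (hM : ∀ k, ∑ i, (A i)ᴴ * pauli k * A i = pauliVec (M k)) (v : Fin 3 → ℝ) :
    (v ᵥ* M) ⬝ᵥ (v ᵥ* M) ≤ v ⬝ᵥ v := by
  set w := v ᵥ* M with hw
  have hX : ∑ i, (A i)ᴴ * pauliVec v * A i = pauliVec w := by
    rw [hw, ← sum_smul_pauliVec]
    simp only [← hM, Finset.smul_sum]
    rw [Finset.sum_comm]
    simp [pauliVec, Matrix.mul_sum, Matrix.sum_mul]
  have hD : ∀ i, (pauliVec v * A i - A i * pauliVec w)ᴴ * (pauliVec v * A i - A i * pauliVec w)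
      = ((v ⬝ᵥ v : ℝ) : ℂ) • ((A i)ᴴ * A i) - ((A i)ᴴ * pauliVec v * A i) * pauliVec w
        - pauliVec w * ((A i)ᴴ * pauliVec v * A i)
        + pauliVec w * ((A i)ᴴ * A i) * pauliVec w := by
    intro i
    have hv : (A i)ᴴ * pauliVec v * (pauliVec v * A i)
        = ((v ⬝ᵥ v : ℝ) : ℂ) • ((A i)ᴴ * A i) := by
      rw [Matrix.mul_assoc, ← Matrix.mul_assoc (pauliVec v), pauliVec_mul_self]
      simp
    rw [conjTranspose_sub, conjTranspose_mul, conjTranspose_mul, pauliVec_conjTranspose,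
      pauliVec_conjTranspose, ← hv]
    noncomm_ring
  have hsum : ∑ i, (pauliVec v * A i - A i * pauliVec w)ᴴ *
      (pauliVec v * A i - A i * pauliVec w)
      = ((v ⬝ᵥ v - w ⬝ᵥ w : ℝ) : ℂ) • (1 : Matrix (Fin 2) (Fin 2) ℂ) := by
    rw [Finset.sum_congr rfl fun i _ => hD i, Finset.sum_add_distrib, Finset.sum_sub_distrib,
      Finset.sum_sub_distrib, ← Finset.smul_sum, ← Matrix.sum_mul, ← Matrix.mul_sum,
      ← Matrix.sum_mul, ← Matrix.mul_sum, hX, hA, Matrix.mul_one, pauliVec_mul_self,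
      Complex.ofReal_sub, sub_smul]
    abel
  have hpos : (((v ⬝ᵥ v - w ⬝ᵥ w : ℝ) : ℂ) • (1 : Matrix (Fin 2) (Fin 2) ℂ)).PosSemidef := by
    rw [← hsum]
    exact Matrix.posSemidef_sum _ fun i _ => Matrix.posSemidef_conjTranspose_mul_self _
  have h0 := hpos.diag_nonneg (i := 0)
  simp only [Matrix.smul_apply, Matrix.one_apply_eq, smul_eq_mul, mul_one] at h0
  have := Complex.zero_le_real.1 h0
  linarith

end Qubit

section Contraction

lemma dotProduct_mulVec_le_of_vecMul {M : Matrix (Fin 3) (Fin 3) ℝ}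
    (hM : ∀ v : Fin 3 → ℝ, (v ᵥ* M) ⬝ᵥ (v ᵥ* M) ≤ v ⬝ᵥ v) (v : Fin 3 → ℝ) :
    (M *ᵥ v) ⬝ᵥ (M *ᵥ v) ≤ v ⬝ᵥ v := by
  have h1 := hM (M *ᵥ v)
  set z := (M *ᵥ v) ᵥ* M with hz
  have h2 : (M *ᵥ v) ⬝ᵥ (M *ᵥ v) = z ⬝ᵥ v := by rw [Matrix.dotProduct_mulVec]
  have h3 : 0 ≤ (v - z) ⬝ᵥ (v - z) := by
    simpa using dotProduct_star_self_nonneg (v - z)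
  simp only [sub_dotProduct, dotProduct_sub] at h3
  rw [dotProduct_comm v z] at h3
  linarith

lemma trace_transpose_mul_self_eq (X : Matrix (Fin 3) (Fin 3) ℝ) :
    (Xᵀ * X).trace = ∑ j, X.col j ⬝ᵥ X.col j := by
  simp [Matrix.trace, Matrix.mul_apply, dotProduct]

lemma trace_transpose_mul_self_le {M : Matrix (Fin 3) (Fin 3) ℝ}
    (hM : ∀ v : Fin 3 → ℝ, (M *ᵥ v) ⬝ᵥ (M *ᵥ v) ≤ v ⬝ᵥ v) (X : Matrix (Fin 3) (Fin 3) ℝ) :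
    ((M * X)ᵀ * (M * X)).trace ≤ (Xᵀ * X).trace := by
  simp only [trace_transpose_mul_self_eq]
  exact Finset.sum_le_sum fun j _ => hM (X.col j)

lemma trace_mul_transpose_le {M N : Matrix (Fin 3) (Fin 3) ℝ}
    (hM : ∀ v : Fin 3 → ℝ, (M *ᵥ v) ⬝ᵥ (M *ᵥ v) ≤ v ⬝ᵥ v)
    (hN : ∀ v : Fin 3 → ℝ, (N *ᵥ v) ⬝ᵥ (N *ᵥ v) ≤ v ⬝ᵥ v) (X : Matrix (Fin 3) (Fin 3) ℝ) :
    ((M * X * Nᵀ)ᵀ * (M * X * Nᵀ)).trace ≤ (Xᵀ * X).trace := by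
  calc ((M * X * Nᵀ)ᵀ * (M * X * Nᵀ)).trace
      = ((N * (M * X)ᵀ)ᵀ * (N * (M * X)ᵀ)).trace := by
        rw [Matrix.trace_mul_comm]
        simp [Matrix.transpose_mul, Matrix.mul_assoc]
    _ ≤ ((M * X)ᵀᵀ * (M * X)ᵀ).trace := trace_transpose_mul_self_le hN _
    _ = ((M * X)ᵀ * (M * X)).trace := by rw [Matrix.trace_mul_comm, Matrix.transpose_transpose]
    _ ≤ (Xᵀ * X).trace := trace_transpose_mul_self_le hM X

end Contraction

section LambdaMax

lemma isCompact_dotProduct_self_eq_one : IsCompact {x : Fin 3 → ℝ | x ⬝ᵥ x = 1} := by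
  refine Metric.isCompact_of_isClosed_isBounded
    (isClosed_eq (by unfold dotProduct; fun_prop) continuous_const) ?_
  refine Metric.isBounded_closedBall (x := (0 : Fin 3 → ℝ)) (r := 1) |>.subset fun x hx => ?_
  rw [mem_closedBall_zero_iff, pi_norm_le_iff_of_nonneg zero_le_one]
  intro i
  have hi : x i * x i ≤ x ⬝ᵥ x :=
    Finset.single_le_sum (f := fun i => x i * x i) (fun j _ => mul_self_nonneg (x j))
      (Finset.mem_univ i)
  rw [show x ⬝ᵥ x = 1 from hx] at hi
  exact abs_le_of_sq_le_sq' (by nlinarith) zero_le_one |> abs_le.2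

lemma dotProduct_transpose_mul_self_mulVec (F : Matrix (Fin 3) (Fin 3) ℝ) (x : Fin 3 → ℝ) :
    x ⬝ᵥ ((Fᵀ * F) *ᵥ x) = (F *ᵥ x) ⬝ᵥ (F *ᵥ x) := by
  rw [← Matrix.mulVec_mulVec, Matrix.dotProduct_mulVec, Matrix.vecMul_transpose]

/-- The largest eigenvalue of `FᵀF` is the attained maximum of the Rayleigh quotient. -/
lemma lambdaMax_spec (F : Matrix (Fin 3) (Fin 3) ℝ) :
    (∃ u : Fin 3 → ℝ, u ⬝ᵥ u = 1 ∧ (F *ᵥ u) ⬝ᵥ (F *ᵥ u) = lambdaMax (Fᵀ * F)) ∧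
      ∀ x : Fin 3 → ℝ, (F *ᵥ x) ⬝ᵥ (F *ᵥ x) ≤ lambdaMax (Fᵀ * F) * (x ⬝ᵥ x) := by
  obtain ⟨u, hu, hmax⟩ := isCompact_dotProduct_self_eq_one.exists_isMaxOn
    ⟨Pi.single 0 1, by simp⟩
    (f := fun x => (F *ᵥ x) ⬝ᵥ (F *ᵥ x))
    (by unfold dotProduct mulVec dotProduct; fun_prop)
  set q := (F *ᵥ u) ⬝ᵥ (F *ᵥ u) with hq
  have hu1 : u ⬝ᵥ u = 1 := hu
  have hle : ∀ x : Fin 3 → ℝ, (F *ᵥ x) ⬝ᵥ (F *ᵥ x) ≤ q * (x ⬝ᵥ x) := by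
    intro x
    by_cases hx : x = 0
    · simp [hx]
    have hpos : 0 < x ⬝ᵥ x := by simpa using dotProduct_star_self_pos_iff.2 hx
    have hs := Real.mul_self_sqrt hpos.le
    have hs0 : Real.sqrt (x ⬝ᵥ x) ≠ 0 := (Real.sqrt_pos.2 hpos).ne'
    have h := hmax (a := (Real.sqrt (x ⬝ᵥ x))⁻¹ • x) (by
      simp only [Set.mem_ofPred_eq, smul_dotProduct, dotProduct_smul, smul_eq_mul]
      field_simp
      nlinarith)
    simp only [Set.mem_ofPred_eq, mulVec_smul, smul_dotProduct, dotProduct_smul,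
      smul_eq_mul] at h
    rw [← mul_assoc, ← mul_inv, hs, inv_mul_le_iff₀ hpos] at h
    linarith
  have hP : (q • (1 : Matrix (Fin 3) (Fin 3) ℝ) - Fᵀ * F).PosSemidef := by
    refine Matrix.PosSemidef.of_dotProduct_mulVec_nonneg ?_ fun x => ?_
    · rw [IsHermitian]
      simp [conjTranspose_eq_transpose_of_trivial, transpose_mul]
    · have := hle x
      simp only [star_trivial, sub_mulVec, smul_mulVec, one_mulVec, dotProduct_sub,
        dotProduct_smul, smul_eq_mul, dotProduct_transpose_mul_self_mulVec]
      linarith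
  have heig : (Fᵀ * F) *ᵥ u = q • u := by
    have h := (hP.dotProduct_mulVec_zero_iff u).1 (by
      simp only [star_trivial, sub_mulVec, smul_mulVec, one_mulVec, dotProduct_sub,
        dotProduct_smul, smul_eq_mul, dotProduct_transpose_mul_self_mulVec, hu1]
      linarith)
    rw [sub_mulVec, smul_mulVec, one_mulVec, sub_eq_zero] at h
    exact h.symm
  have hlam : lambdaMax (Fᵀ * F) = q := by
    refine IsGreatest.csSup_eq ⟨⟨u, ?_, heig⟩, ?_⟩
    · rintro rfl
      simp at hu1
    · rintro y ⟨v, hv, hy⟩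
      have hpos : 0 < v ⬝ᵥ v := by simpa using dotProduct_star_self_pos_iff.2 hv
      have h := hle v
      rw [← dotProduct_transpose_mul_self_mulVec, hy, dotProduct_smul, smul_eq_mul] at h
      exact le_of_mul_le_mul_right h hpos
  rw [hlam]
  exact ⟨⟨u, hu1, rfl⟩, hle⟩

lemma trace_sub_vecMulVec (F : Matrix (Fin 3) (Fin 3) ℝ) (a b : Fin 3 → ℝ) :
    ((F - vecMulVec a b)ᵀ * (F - vecMulVec a b)).trace
      = (Fᵀ * F).trace - 2 * (a ⬝ᵥ (F *ᵥ b)) + (a ⬝ᵥ a) * (b ⬝ᵥ b) := by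
  simp [Matrix.trace, Matrix.mul_apply, Fin.sum_univ_three, vecMulVec_apply, dotProduct, mulVec]
  ring

/-- Lower bound on the Frobenius distance to a rank-one matrix. -/
lemma trace_sub_lambdaMax_le (F : Matrix (Fin 3) (Fin 3) ℝ) (a b : Fin 3 → ℝ) :
    (Fᵀ * F).trace - lambdaMax (Fᵀ * F)
      ≤ ((F - vecMulVec a b)ᵀ * (F - vecMulVec a b)).trace := by
  obtain ⟨⟨u, -, hu⟩, hle⟩ := lambdaMax_spec F
  have hnn : ∀ x : Fin 3 → ℝ, 0 ≤ x ⬝ᵥ x := fun x => by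
    simpa using dotProduct_star_self_nonneg x
  have hlam : 0 ≤ lambdaMax (Fᵀ * F) := hu ▸ hnn _
  have hcs : (a ⬝ᵥ (F *ᵥ b)) ^ 2 ≤ (a ⬝ᵥ a) * ((F *ᵥ b) ⬝ᵥ (F *ᵥ b)) := by
    simpa [dotProduct, sq] using Finset.sum_mul_sq_le_sq_mul_sq Finset.univ a (F *ᵥ b)
  have hb := mul_le_mul_of_nonneg_left (hle b) (hnn a)
  have hp := mul_nonneg (hnn a) (hnn b)
  rw [trace_sub_vecMulVec]
  have : 2 * (a ⬝ᵥ (F *ᵥ b)) ≤ (a ⬝ᵥ a) * (b ⬝ᵥ b) + lambdaMax (Fᵀ * F) := by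
    refine (abs_le_of_sq_le_sq' ?_ (by linarith)).2
    nlinarith [sq_nonneg ((a ⬝ᵥ a) * (b ⬝ᵥ b) - lambdaMax (Fᵀ * F))]
  linarith

lemma trace_sub_lambdaMax_mul_le {M N : Matrix (Fin 3) (Fin 3) ℝ}
    (hM : ∀ v : Fin 3 → ℝ, (M *ᵥ v) ⬝ᵥ (M *ᵥ v) ≤ v ⬝ᵥ v)
    (hN : ∀ v : Fin 3 → ℝ, (N *ᵥ v) ⬝ᵥ (N *ᵥ v) ≤ v ⬝ᵥ v) (E : Matrix (Fin 3) (Fin 3) ℝ) :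
    ((M * E * Nᵀ)ᵀ * (M * E * Nᵀ)).trace - lambdaMax ((M * E * Nᵀ)ᵀ * (M * E * Nᵀ))
      ≤ (Eᵀ * E).trace - lambdaMax (Eᵀ * E) := by
  obtain ⟨⟨u, hu1, hu⟩, -⟩ := lambdaMax_spec E
  have h1 := trace_sub_lambdaMax_le (M * E * Nᵀ) (M *ᵥ (E *ᵥ u)) (N *ᵥ u)
  have h2 := trace_mul_transpose_le hM hN (E - vecMulVec (E *ᵥ u) u)
  have h3 : M * (E - vecMulVec (E *ᵥ u) u) * Nᵀ
      = M * E * Nᵀ - vecMulVec (M *ᵥ (E *ᵥ u)) (N *ᵥ u) := by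
    rw [Matrix.mul_sub, Matrix.sub_mul, Matrix.mul_vecMulVec, Matrix.vecMulVec_mul,
      Matrix.vecMul_transpose]
  rw [h3, trace_sub_vecMulVec E, hu, hu1] at h2
  linarith

end LambdaMax

lemma corr_local_channel {m n : ℕ} {A : Fin m → Matrix (Fin 2) (Fin 2) ℂ}
    {B : Fin n → Matrix (Fin 2) (Fin 2) ℂ} {M N : Matrix (Fin 3) (Fin 3) ℝ}
    (hM : ∀ k, ∑ i, (A i)ᴴ * pauli k * A i = pauliVec (M k))
    (hN : ∀ k, ∑ j, (B j)ᴴ * pauli k * B j = pauliVec (N k))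
    (ρ : Matrix (Fin 2 × Fin 2) (Fin 2 × Fin 2) ℂ) :
    corr (∑ i, ∑ j, (A i ⊗ₖ B j) * ρ * (A i ⊗ₖ B j)ᴴ) = M * corr ρ * Nᵀ := by
  ext k l
  have h : ((∑ i, ∑ j, (A i ⊗ₖ B j) * ρ * (A i ⊗ₖ B j)ᴴ) * (pauli k ⊗ₖ pauli l)).trace
      = (ρ * (pauliVec (M k) ⊗ₖ pauliVec (N l))).trace := by
    have hterm : ∀ i j, ((A i ⊗ₖ B j) * ρ * (A i ⊗ₖ B j)ᴴ * (pauli k ⊗ₖ pauli l)).trace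
        = (ρ * (((A i)ᴴ * pauli k * A i) ⊗ₖ ((B j)ᴴ * pauli l * B j))).trace := fun i j => by
      rw [Matrix.mul_assoc, Matrix.mul_assoc, Matrix.trace_mul_comm, conjTranspose_kronecker,
        Matrix.mul_kronecker_mul, Matrix.mul_kronecker_mul]
      simp only [Matrix.mul_assoc]
    have hkron : pauliVec (M k) ⊗ₖ pauliVec (N l)
        = ∑ i, ∑ j, ((A i)ᴴ * pauli k * A i) ⊗ₖ ((B j)ᴴ * pauli l * B j) := by
      rw [← hM, ← hN]
      ext x y
      simp [kroneckerMap_apply, Matrix.sum_apply, Finset.sum_mul_sum]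
    rw [hkron]
    simp only [Matrix.sum_mul, Matrix.mul_sum, Matrix.trace_sum, hterm]
  have hkron : pauliVec (M k) ⊗ₖ pauliVec (N l)
      = ∑ k', ∑ l', ((M k k' * N l l' : ℝ) : ℂ) • (pauli k' ⊗ₖ pauli l') := by
    ext x y
    simp only [pauliVec, kroneckerMap_apply, Matrix.sum_apply, Matrix.smul_apply, smul_eq_mul,
      Finset.sum_mul_sum, Complex.ofReal_mul]
    exact Finset.sum_congr rfl fun _ _ => Finset.sum_congr rfl fun _ _ => by ring
  rw [corr, Matrix.of_apply, h, hkron]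
  simp only [Matrix.mul_sum, Matrix.mul_smul, Matrix.trace_sum, Matrix.trace_smul, smul_eq_mul,
    Complex.re_sum, Complex.re_ofReal_mul, Matrix.mul_apply, Matrix.transpose_apply,
    Finset.sum_mul, corr, Matrix.of_apply]
  rw [Finset.sum_comm]
  exact Finset.sum_congr rfl fun _ _ => Finset.sum_congr rfl fun _ _ => by ring

/-- RSP-fidelity of a two-qubit state does not increase under local unital
quantum operations given in Kraus form. -/
theorem frsp_nonincreasing_local_unital
    (ρ : Matrix (Fin 2 × Fin 2) (Fin 2 × Fin 2) ℂ)
    (hρ : ρ.PosSemidef) (hτ : Matrix.trace ρ = 1)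
    (m n : ℕ) (A : Fin m → Matrix (Fin 2) (Fin 2) ℂ) (B : Fin n → Matrix (Fin 2) (Fin 2) ℂ)
    (hA : ∑ i, (A i)ᴴ * A i = 1) (hA' : ∑ i, A i * (A i)ᴴ = 1)
    (hB : ∑ j, (B j)ᴴ * B j = 1) (hB' : ∑ j, B j * (B j)ᴴ = 1) :
    Frsp (∑ i : Fin m, ∑ j : Fin n, (A i ⊗ₖ B j) * ρ * (A i ⊗ₖ B j)ᴴ) ≤ Frsp ρ := by
  obtain ⟨M, hM⟩ := exists_bloch_matrix hA'
  obtain ⟨N, hN⟩ := exists_bloch_matrix hB'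
  have h := trace_sub_lambdaMax_mul_le
    (dotProduct_mulVec_le_of_vecMul (dotProduct_vecMul_le hA hM))
    (dotProduct_mulVec_le_of_vecMul (dotProduct_vecMul_le hB hN)) (corr ρ)
  rw [Frsp, Frsp, corr_local_channel hM hN]
  linarith

end
end

section
/- For any two-qubit state ρ and any unitary 2×2 complex matrices U₁ and U₂, F_RSP((U₁ ⊗ U₂) ρ (U₁ ⊗ U₂)†) = F_RSP(ρ), i.e., the RSP-fidelity is invariant under local unitary transformations. -/
open Matrix Kronecker ComplexOrder

noncomputable section

theorem isHermitian_pauli (k : Fin 3) : (pauli k).IsHermitian := by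
  ext i j
  fin_cases k <;> fin_cases i <;> fin_cases j <;> simp [pauli]

theorem trace_pauli (k : Fin 3) : (pauli k).trace = 0 := by
  fin_cases k <;> simp [pauli, Matrix.trace_fin_two]

theorem trace_pauli_mul_pauli (k l : Fin 3) :
    (pauli k * pauli l).trace = if k = l then 2 else 0 := by
  fin_cases k <;> fin_cases l <;> simp [pauli, Matrix.trace_fin_two] <;> norm_num

/-- The coordinates of a traceless Hermitian matrix in the Pauli basis. -/
theorem eq_sum_smul_pauli {X : Matrix (Fin 2) (Fin 2) ℂ} (hX : X.IsHermitian)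
    (h0 : X.trace = 0) :
    X = ∑ a, (((X * pauli a).trace.re / 2 : ℝ) : ℂ) • pauli a := by
  have h00 := hX.apply 0 0
  have h01 := hX.apply 0 1
  rw [Matrix.trace_fin_two] at h0
  simp only [Complex.ext_iff, Complex.star_def, Complex.conj_re, Complex.conj_im, Complex.add_re,
    Complex.add_im, Complex.zero_re, Complex.zero_im] at h00 h01 h0
  obtain ⟨h0r, h0i⟩ := h0
  obtain ⟨-, h00⟩ := h00
  obtain ⟨h01r, h01i⟩ := h01
  ext i j
  fin_cases i <;> fin_cases j <;>
    simp [Fin.sum_univ_three, pauli, Matrix.trace_fin_two, Matrix.mul_apply, Complex.ext_iff] <;>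
    constructor <;> linarith

/-- The real matrix of the adjoint action `σ ↦ Uᴴ * σ * U` in the Pauli basis. -/
def pauliRotation (U : Matrix (Fin 2) (Fin 2) ℂ) : Matrix (Fin 3) (Fin 3) ℝ :=
  Matrix.of fun k a => (Uᴴ * pauli k * U * pauli a).trace.re / 2

theorem conj_pauli {U : Matrix (Fin 2) (Fin 2) ℂ} (hU : Uᴴ * U = 1) (k : Fin 3) :
    Uᴴ * pauli k * U = ∑ a, (pauliRotation U k a : ℂ) • pauli a := by
  refine eq_sum_smul_pauli (isHermitian_conjTranspose_mul_mul U (isHermitian_pauli k)) ?_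
  rw [Matrix.trace_mul_comm, ← Matrix.mul_assoc, mul_eq_one_comm.mp hU, Matrix.one_mul,
    trace_pauli]

theorem pauliRotation_mul_transpose {U : Matrix (Fin 2) (Fin 2) ℂ} (hU : Uᴴ * U = 1) :
    pauliRotation U * (pauliRotation U)ᵀ = 1 := by
  ext k l
  have hU' : U * Uᴴ = 1 := mul_eq_one_comm.mp hU
  have h1 : ((Uᴴ * pauli k * U) * (Uᴴ * pauli l * U)).trace = if k = l then 2 else 0 := by
    have : (Uᴴ * pauli k * U) * (Uᴴ * pauli l * U) = Uᴴ * (pauli k * pauli l * U) := by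
      calc _ = Uᴴ * (pauli k * (U * Uᴴ) * pauli l * U) := by simp only [Matrix.mul_assoc]
        _ = _ := by rw [hU', Matrix.mul_one]
    rw [this, Matrix.trace_mul_comm, Matrix.mul_assoc, hU', Matrix.mul_one,
      trace_pauli_mul_pauli]
  rw [conj_pauli hU, conj_pauli hU] at h1
  simp only [Finset.sum_mul, Finset.mul_sum, Matrix.smul_mul, Matrix.mul_smul, Matrix.trace_sum,
    Matrix.trace_smul, trace_pauli_mul_pauli, smul_eq_mul, mul_ite, mul_zero,
    Finset.sum_ite_eq', Finset.mem_univ, if_true] at h1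
  have h2 := congrArg Complex.re h1
  rw [Matrix.mul_apply, Matrix.one_apply]
  simp only [Fin.sum_univ_three, Matrix.transpose_apply] at h2 ⊢
  split_ifs at h2 ⊢ <;> simp at h2 <;> linarith

theorem corr_conj {U₁ U₂ : Matrix (Fin 2) (Fin 2) ℂ} (hU₁ : U₁ᴴ * U₁ = 1) (hU₂ : U₂ᴴ * U₂ = 1)
    (ρ : Matrix (Fin 2 × Fin 2) (Fin 2 × Fin 2) ℂ) :
    corr ((U₁ ⊗ₖ U₂) * ρ * (U₁ ⊗ₖ U₂)ᴴ) =
      pauliRotation U₁ * corr ρ * (pauliRotation U₂)ᵀ := by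
  ext k l
  have h : ((U₁ ⊗ₖ U₂) * ρ * (U₁ ⊗ₖ U₂)ᴴ * (pauli k ⊗ₖ pauli l)).trace =
      (ρ * ((U₁ᴴ * pauli k * U₁) ⊗ₖ (U₂ᴴ * pauli l * U₂))).trace := by
    rw [Matrix.mul_kronecker_mul, Matrix.mul_kronecker_mul, ← conjTranspose_kronecker,
      Matrix.mul_assoc, Matrix.mul_assoc, Matrix.trace_mul_comm]
    simp only [Matrix.mul_assoc]
  rw [conj_pauli hU₁, conj_pauli hU₂] at h
  simp only [corr, Matrix.of_apply, h, Matrix.mul_apply, Matrix.transpose_apply,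
    Fin.sum_univ_three, Matrix.add_kronecker, Matrix.kronecker_add, Matrix.smul_kronecker,
    Matrix.kronecker_smul, Matrix.mul_add, Matrix.mul_smul, Matrix.trace_add, Matrix.trace_smul,
    smul_eq_mul, Complex.add_re, Complex.re_ofReal_mul]
  ring

theorem lambdaMax_conj {R : Matrix (Fin 3) (Fin 3) ℝ} (hR : R * Rᵀ = 1)
    (M : Matrix (Fin 3) (Fin 3) ℝ) : lambdaMax (R * M * Rᵀ) = lambdaMax M := by
  have hR' : Rᵀ * R = 1 := mul_eq_one_comm.mp hR
  unfold lambdaMax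
  congr 1
  ext x
  constructor
  · rintro ⟨v, hv, h⟩
    refine ⟨Rᵀ *ᵥ v, fun h0 => hv ?_, ?_⟩
    · rw [← Matrix.one_mulVec v, ← hR, ← Matrix.mulVec_mulVec, h0, Matrix.mulVec_zero]
    · have := congrArg (Rᵀ *ᵥ ·) h
      simpa [Matrix.mulVec_mulVec, ← Matrix.mul_assoc, hR', Matrix.mulVec_smul] using this
  · rintro ⟨v, hv, h⟩
    refine ⟨R *ᵥ v, fun h0 => hv ?_, ?_⟩
    · rw [← Matrix.one_mulVec v, ← hR', ← Matrix.mulVec_mulVec, h0, Matrix.mulVec_zero]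
    · rw [Matrix.mulVec_mulVec, Matrix.mul_assoc, hR', Matrix.mul_one, ← Matrix.mulVec_mulVec, h,
        Matrix.mulVec_smul]

/-- RSP-fidelity is invariant under local unitary transformations. -/
theorem frsp_local_unitary_invariant
    (ρ : Matrix (Fin 2 × Fin 2) (Fin 2 × Fin 2) ℂ)
    (hρ : ρ.PosSemidef) (hτ : Matrix.trace ρ = 1)
    (U₁ U₂ : Matrix (Fin 2) (Fin 2) ℂ)
    (hU₁ : U₁ᴴ * U₁ = 1) (hU₂ : U₂ᴴ * U₂ = 1) :
    Frsp ((U₁ ⊗ₖ U₂) * ρ * (U₁ ⊗ₖ U₂)ᴴ) = Frsp ρ := by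
  have h₁ : (pauliRotation U₁)ᵀ * pauliRotation U₁ = 1 :=
    mul_eq_one_comm.mp (pauliRotation_mul_transpose hU₁)
  have h₂ := pauliRotation_mul_transpose hU₂
  have h : (corr ((U₁ ⊗ₖ U₂) * ρ * (U₁ ⊗ₖ U₂)ᴴ))ᵀ * corr ((U₁ ⊗ₖ U₂) * ρ * (U₁ ⊗ₖ U₂)ᴴ) =
      pauliRotation U₂ * ((corr ρ)ᵀ * corr ρ) * (pauliRotation U₂)ᵀ := by
    rw [corr_conj hU₁ hU₂]
    calc _ = pauliRotation U₂ * ((corr ρ)ᵀ * ((pauliRotation U₁)ᵀ * pauliRotation U₁) * corr ρ) *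
          (pauliRotation U₂)ᵀ := by
          simp only [Matrix.transpose_mul, Matrix.transpose_transpose, Matrix.mul_assoc]
      _ = _ := by rw [h₁, Matrix.mul_one]
  rw [Frsp, Frsp, h, lambdaMax_conj h₂, Matrix.trace_mul_comm, ← Matrix.mul_assoc,
    mul_eq_one_comm.mp h₂, Matrix.one_mul]

end
end

section
/- For every two-qubit state ρ, the (normalized) geometric measure of quantum discord dominates the RSP-fidelity: D_G(ρ) ≥ F_RSP(ρ), where D_G(ρ) := ½(|a|² + tr(E Eᵀ) − λ_max(a aᵀ + E Eᵀ)), a = a(ρ) is the local Bloch vector of the first qubit and E = E(ρ) is the correlation matrix. -/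
open Matrix Kronecker ComplexOrder

noncomputable section

theorem bddAbove_eigenvalues (M : Matrix (Fin 3) (Fin 3) ℝ) :
    BddAbove {x : ℝ | ∃ v : Fin 3 → ℝ, v ≠ 0 ∧ M.mulVec v = x • v} := by
  refine Set.Finite.bddAbove ((Module.End.finite_hasEigenvalue (Matrix.toLin' M)).subset ?_)
  rintro x ⟨v, hv, h⟩
  refine Module.End.hasEigenvalue_of_hasEigenvector (x := v) ?_
  rw [Module.End.hasEigenvector_iff, Module.End.mem_eigenspace_iff]
  exact ⟨by simpa using h, hv⟩

theorem le_lambdaMax {M : Matrix (Fin 3) (Fin 3) ℝ} {x : ℝ} {v : Fin 3 → ℝ} (hv : v ≠ 0)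
    (h : M.mulVec v = x • v) : x ≤ lambdaMax M :=
  le_csSup (bddAbove_eigenvalues M) ⟨v, hv, h⟩

theorem posSemidef_lambdaMax_smul_one_sub {M : Matrix (Fin 3) (Fin 3) ℝ} (hM : M.IsHermitian) :
    (lambdaMax M • (1 : Matrix (Fin 3) (Fin 3) ℝ) - M).PosSemidef := by
  have hA : (lambdaMax M • (1 : Matrix (Fin 3) (Fin 3) ℝ) - M).IsHermitian := by
    refine Matrix.IsHermitian.sub ?_ hM
    simp [Matrix.IsHermitian]
  rw [hA.posSemidef_iff_eigenvalues_nonneg]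
  intro i
  have h := hA.mulVec_eigenvectorBasis i
  have hne : (hA.eigenvectorBasis i).ofLp ≠ 0 := by
    simpa using hA.eigenvectorBasis.orthonormal.ne_zero i
  have hle : lambdaMax M - hA.eigenvalues i ≤ lambdaMax M := by
    refine le_lambdaMax hne ?_
    rw [sub_smul, ← h, Matrix.sub_mulVec, Matrix.smul_mulVec, Matrix.one_mulVec]
    simp
  simpa using hle

theorem dotProduct_mulVec_le_lambdaMax {M : Matrix (Fin 3) (Fin 3) ℝ} (hM : M.IsHermitian)
    (v : Fin 3 → ℝ) : v ⬝ᵥ M.mulVec v ≤ lambdaMax M * (v ⬝ᵥ v) := by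
  have h := (posSemidef_lambdaMax_smul_one_sub hM).dotProduct_mulVec_nonneg v
  rw [Matrix.sub_mulVec, Matrix.smul_mulVec, Matrix.one_mulVec] at h
  simpa [dotProduct_sub] using h

theorem dotProduct_sq_le (u v : Fin 3 → ℝ) : (u ⬝ᵥ v) ^ 2 ≤ (u ⬝ᵥ u) * (v ⬝ᵥ v) := by
  simpa [dotProduct, ← sq] using Finset.sum_mul_sq_le_sq_mul_sq Finset.univ u v

theorem dotProduct_self_nonneg_real (v : Fin 3 → ℝ) : 0 ≤ v ⬝ᵥ v :=
  Finset.sum_nonneg fun i _ => mul_self_nonneg (v i)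

theorem mulVec_dotProduct_self_le (E : Matrix (Fin 3) (Fin 3) ℝ) (w : Fin 3 → ℝ) :
    E.mulVec w ⬝ᵥ E.mulVec w ≤ lambdaMax (Eᵀ * E) * (w ⬝ᵥ w) := by
  have h := dotProduct_mulVec_le_lambdaMax (M := Eᵀ * E)
    (by simp [Matrix.IsHermitian, Matrix.conjTranspose_eq_transpose_of_trivial]) w
  rwa [← Matrix.mulVec_mulVec, Matrix.dotProduct_mulVec, Matrix.vecMul_transpose] at h

theorem lambdaMax_transpose_mul_self_nonneg (E : Matrix (Fin 3) (Fin 3) ℝ) :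
    0 ≤ lambdaMax (Eᵀ * E) := by
  have h := mulVec_dotProduct_self_le E (Pi.single 0 1)
  have h0 := dotProduct_self_nonneg_real (E.mulVec (Pi.single 0 1))
  have h1 : (Pi.single 0 1 : Fin 3 → ℝ) ⬝ᵥ Pi.single 0 1 = 1 := by simp
  rw [h1, mul_one] at h
  exact h0.trans h

theorem transpose_mulVec_dotProduct_self_le (E : Matrix (Fin 3) (Fin 3) ℝ) (v : Fin 3 → ℝ) :
    Eᵀ.mulVec v ⬝ᵥ Eᵀ.mulVec v ≤ lambdaMax (Eᵀ * E) * (v ⬝ᵥ v) := by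
  set w := Eᵀ.mulVec v with hw
  have hL := lambdaMax_transpose_mul_self_nonneg E
  have hv := dotProduct_self_nonneg_real v
  have hE := mulVec_dotProduct_self_le E w
  have hwv : w ⬝ᵥ w = v ⬝ᵥ E.mulVec w := by
    rw [Matrix.dotProduct_mulVec v E, ← Matrix.mulVec_transpose]
  have hcs := dotProduct_sq_le v (E.mulVec w)
  rw [← hwv] at hcs
  rcases (dotProduct_self_nonneg_real w).eq_or_lt with h0 | h0
  · rw [← h0]
    positivity
  · refine le_of_mul_le_mul_right ?_ h0
    nlinarith [mul_le_mul_of_nonneg_left hE hv]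

theorem lambdaMax_vecMulVec_add_le (a : Fin 3 → ℝ) (E : Matrix (Fin 3) (Fin 3) ℝ) :
    lambdaMax (Matrix.vecMulVec a a + E * Eᵀ) ≤ a ⬝ᵥ a + lambdaMax (Eᵀ * E) := by
  refine Real.sSup_le ?_
    (add_nonneg (dotProduct_self_nonneg_real a) (lambdaMax_transpose_mul_self_nonneg E))
  rintro x ⟨v, hv, h⟩
  have hpos : 0 < v ⬝ᵥ v :=
    (dotProduct_self_nonneg_real v).lt_of_ne' (by simpa [dotProduct_self_eq_zero] using hv)
  have hx : (a ⬝ᵥ v) ^ 2 + Eᵀ.mulVec v ⬝ᵥ Eᵀ.mulVec v = x * (v ⬝ᵥ v) := by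
    have := congrArg (v ⬝ᵥ ·) h
    simp only [dotProduct_smul, smul_eq_mul] at this
    rw [← this, Matrix.add_mulVec, dotProduct_add, ← Matrix.mulVec_mulVec,
      Matrix.dotProduct_mulVec v E, ← Matrix.mulVec_transpose, Matrix.vecMulVec_mulVec]
    simp [dotProduct_comm v a, sq]
  refine le_of_mul_le_mul_right ?_ hpos
  rw [← hx, add_mul]
  exact add_le_add (dotProduct_sq_le a v) (transpose_mulVec_dotProduct_self_le E v)

/-- The (normalized) geometric measure of quantum discord dominates the RSP-fidelity. -/
theorem dg_ge_frsp
    (ρ : Matrix (Fin 2 × Fin 2) (Fin 2 × Fin 2) ℂ)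
    (hρ : ρ.PosSemidef) (hτ : Matrix.trace ρ = 1) :
    Dg ρ ≥ Frsp ρ := by
  have h := lambdaMax_vecMulVec_add_le (bloch ρ) (corr ρ)
  have ha : bloch ρ ⬝ᵥ bloch ρ = ∑ k, bloch ρ k ^ 2 := by simp [dotProduct, sq]
  have ht := Matrix.trace_mul_comm (corr ρ) (corr ρ)ᵀ
  unfold Dg Frsp
  linarith

end
end

section
/- For any real numbers c₁, c₂, c₃ and any p ∈ [0,1] with q := 1 − p, the symmetric local amplitude damping channel maps the Bell-diagonal state ρ(c₁,c₂,c₃) to Φ_p(ρ(c₁,c₂,c₃)) = ¼[ I₄ + p (I₂ ⊗ σ₃ + σ₃ ⊗ I₂) + q c₁ σ₁ ⊗ σ₁ + q c₂ σ₂ ⊗ σ₂ + (c₃ q² + p²) σ₃ ⊗ σ₃ ]. -/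
open Matrix Kronecker ComplexOrder

noncomputable section

/-- The single-qubit amplitude damping channel. -/
def ampDamp (p : ℝ) (A : Matrix (Fin 2) (Fin 2) ℂ) : Matrix (Fin 2) (Fin 2) ℂ :=
  ∑ i : Fin 2, damp p i * A * (damp p i)ᴴ

theorem Phi_add (p : ℝ) (ρ τ : Matrix (Fin 2 × Fin 2) (Fin 2 × Fin 2) ℂ) :
    Phi p (ρ + τ) = Phi p ρ + Phi p τ := by
  simp only [Phi, Matrix.mul_add, Matrix.add_mul, Finset.sum_add_distrib]

theorem Phi_smul (p : ℝ) (a : ℂ) (ρ : Matrix (Fin 2 × Fin 2) (Fin 2 × Fin 2) ℂ) :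
    Phi p (a • ρ) = a • Phi p ρ := by
  simp only [Phi, Matrix.mul_smul, Matrix.smul_mul, Finset.smul_sum]

theorem Phi_kronecker (p : ℝ) (A B : Matrix (Fin 2) (Fin 2) ℂ) :
    Phi p (A ⊗ₖ B) = ampDamp p A ⊗ₖ ampDamp p B := by
  simp only [Phi, ampDamp, conjTranspose_kronecker, ← mul_kronecker_mul, Fin.sum_univ_two,
    add_kronecker, kronecker_add]
  abel

theorem ofReal_sqrt_mul_self {x : ℝ} (hx : 0 ≤ x) :
    (Real.sqrt x : ℂ) * (Real.sqrt x : ℂ) = x := by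
  rw [← Complex.ofReal_mul, Real.mul_self_sqrt hx]

theorem ampDamp_one {p : ℝ} (hp : p ∈ Set.Icc (0 : ℝ) 1) :
    ampDamp p 1 = 1 + (p : ℂ) • pauli 2 := by
  have h₁ := ofReal_sqrt_mul_self hp.1
  have h₂ := ofReal_sqrt_mul_self (sub_nonneg.2 hp.2)
  ext i j
  fin_cases i <;> fin_cases j <;>
    simp [ampDamp, damp, pauli, Matrix.vecMul, dotProduct, Fin.sum_univ_two, h₁, h₂,
      ← sub_eq_add_neg]

theorem ampDamp_pauli_zero (p : ℝ) :
    ampDamp p (pauli 0) = (Real.sqrt (1 - p) : ℂ) • pauli 0 := by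
  ext i j
  fin_cases i <;> fin_cases j <;>
    simp [ampDamp, damp, pauli, Matrix.vecMul, dotProduct, Fin.sum_univ_two]

theorem ampDamp_pauli_one (p : ℝ) :
    ampDamp p (pauli 1) = (Real.sqrt (1 - p) : ℂ) • pauli 1 := by
  ext i j
  fin_cases i <;> fin_cases j <;>
    simp [ampDamp, damp, pauli, Matrix.vecMul, dotProduct, Fin.sum_univ_two, mul_comm]

theorem ampDamp_pauli_two {p : ℝ} (hp : p ∈ Set.Icc (0 : ℝ) 1) :
    ampDamp p (pauli 2) = ((1 - p : ℝ) : ℂ) • pauli 2 := by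
  have h₁ := ofReal_sqrt_mul_self hp.1
  have h₂ := ofReal_sqrt_mul_self (sub_nonneg.2 hp.2)
  ext i j
  fin_cases i <;> fin_cases j <;>
    simp [ampDamp, damp, pauli, Matrix.vecMul, dotProduct, Fin.sum_univ_two, h₁, h₂,
      ← sub_eq_add_neg]

/-- Action of the symmetric local amplitude damping channel on a Bell-diagonal state. -/
theorem amplitude_damping_on_bellDiag
    (c₁ c₂ c₃ : ℝ) (p : ℝ) (hp : p ∈ Set.Icc (0 : ℝ) 1) :
    Phi p (bellDiag c₁ c₂ c₃) =
      (1 / 4 : ℂ) • ((1 : Matrix (Fin 2 × Fin 2) (Fin 2 × Fin 2) ℂ)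
        + (p : ℂ) • ((1 : Matrix (Fin 2) (Fin 2) ℂ) ⊗ₖ pauli 2
            + pauli 2 ⊗ₖ (1 : Matrix (Fin 2) (Fin 2) ℂ))
        + (((1 - p) * c₁ : ℝ) : ℂ) • (pauli 0 ⊗ₖ pauli 0)
        + (((1 - p) * c₂ : ℝ) : ℂ) • (pauli 1 ⊗ₖ pauli 1)
        + ((c₃ * (1 - p) ^ 2 + p ^ 2 : ℝ) : ℂ) • (pauli 2 ⊗ₖ pauli 2)) := by
  have h := ofReal_sqrt_mul_self (sub_nonneg.2 hp.2)
  rw [bellDiag, ← one_kronecker_one]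
  simp only [Phi_smul, Phi_add, Phi_kronecker, ampDamp_one hp, ampDamp_pauli_zero,
    ampDamp_pauli_one, ampDamp_pauli_two hp, add_kronecker, kronecker_add, smul_kronecker,
    kronecker_smul, smul_smul, h]
  push_cast
  module

end
end

section
/- The two-qubit state ρ' := ½(|00⟩⟨00| + |+1⟩⟨+1|), where |+⟩ = (|0⟩ + |1⟩)/√2, is not a classical-quantum state: there do not exist an orthonormal pair of vectors |ψ₁⟩, |ψ₂⟩ ∈ ℂ², nonnegative reals p₁, p₂ with p₁ + p₂ = 1, and single-qubit density matrices σ₁, σ₂ (2×2 positive semidefinite with trace 1) such that ρ' = p₁ |ψ₁⟩⟨ψ₁| ⊗ σ₁ + p₂ |ψ₂⟩⟨ψ₂| ⊗ σ₂. Hence ρ' has nonzero quantum discord, although it is obtained from the zero-discord state ½(|00⟩⟨00| + |11⟩⟨11|) by a local operation on the first qubit. -/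
open Matrix Kronecker ComplexOrder

noncomputable section

def ket0 : Fin 2 → ℂ := ![1, 0]
def ket1 : Fin 2 → ℂ := ![0, 1]
def ketPlus : Fin 2 → ℂ := ![(Real.sqrt 2 : ℂ)⁻¹, (Real.sqrt 2 : ℂ)⁻¹]

/-- The Kronecker (tensor) product of two single-qubit vectors. -/
def kronVec (φ ψ : Fin 2 → ℂ) : Fin 2 × Fin 2 → ℂ := fun x => φ x.1 * ψ x.2

/-- The rank-one projection |ψ⟩⟨ψ| (for vectors on an arbitrary index type). -/
def proj {m : Type*} (ψ : m → ℂ) : Matrix m m ℂ :=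
  Matrix.vecMulVec ψ (star ψ)

/-- The state ρ' = ½(|00⟩⟨00| + |+1⟩⟨+1|). -/
def ρ' : Matrix (Fin 2 × Fin 2) (Fin 2 × Fin 2) ℂ :=
  (1 / 2 : ℂ) • (proj (kronVec ket0 ket0) + proj (kronVec ketPlus ket1))

theorem proj_mul_proj_of_orthogonal {m : Type*} [Fintype m] {φ ψ : m → ℂ}
    (h : star φ ⬝ᵥ ψ = 0) : proj φ * proj ψ = 0 := by
  simp [proj, Matrix.vecMulVec_mul_vecMulVec, h]

/-- Any two linear combinations of orthogonal rank-one projections commute. -/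
theorem commute_proj_combination {m : Type*} [Fintype m] {φ ψ : m → ℂ}
    (h : star φ ⬝ᵥ ψ = 0) (a b c d : ℂ) :
    Commute (a • proj φ + b • proj ψ) (c • proj φ + d • proj ψ) := by
  have h' : star ψ ⬝ᵥ φ = 0 := by
    rw [← star_star (star ψ ⬝ᵥ φ), Matrix.star_dotProduct, star_star, h, star_zero]
  simp only [Commute, SemiconjBy, mul_add, add_mul, smul_mul_smul_comm,
    proj_mul_proj_of_orthogonal h, proj_mul_proj_of_orthogonal h', smul_zero, mul_comm c,
    mul_comm d]

/-- The diagonal block of a two-qubit operator at the index `b` of the second qubit. -/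
def diagBlock (M : Matrix (Fin 2 × Fin 2) (Fin 2 × Fin 2) ℂ) (b : Fin 2) :
    Matrix (Fin 2) (Fin 2) ℂ :=
  M.submatrix (fun i => (i, b)) (fun i => (i, b))

theorem diagBlock_add_smul_kronecker (p q : ℂ) (A B σ τ : Matrix (Fin 2) (Fin 2) ℂ)
    (b : Fin 2) :
    diagBlock (p • (A ⊗ₖ σ) + q • (B ⊗ₖ τ)) b = (p * σ b b) • A + (q * τ b b) • B := by
  ext i j
  simp [diagBlock]
  ring

theorem diagBlock_ρ'_zero : diagBlock ρ' 0 = !![1 / 2, 0; 0, 0] := by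
  ext i j
  fin_cases i <;> fin_cases j <;>
    simp [diagBlock, ρ', proj, kronVec, ket0, ket1, Matrix.vecMulVec_apply]

theorem diagBlock_ρ'_one : diagBlock ρ' 1 = !![1 / 4, 1 / 4; 1 / 4, 1 / 4] := by
  have h : (Real.sqrt 2 : ℂ)⁻¹ * (Real.sqrt 2 : ℂ)⁻¹ = 1 / 2 := by
    rw [← mul_inv, ← Complex.ofReal_mul, Real.mul_self_sqrt zero_le_two]
    norm_num
  ext i j
  fin_cases i <;> fin_cases j <;>
    simp [diagBlock, ρ', proj, kronVec, ket0, ket1, ketPlus, Matrix.vecMulVec_apply, h] <;>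
    norm_num

theorem not_commute_diagBlock_ρ' : ¬ Commute (diagBlock ρ' 0) (diagBlock ρ' 1) := by
  intro h
  rw [diagBlock_ρ'_zero, diagBlock_ρ'_one] at h
  have h01 := congrFun (congrFun h.eq 0) 1
  norm_num [Matrix.mul_apply, Fin.sum_univ_two] at h01

/-- ρ' = ½(|00⟩⟨00| + |+1⟩⟨+1|) is not a classical-quantum state. -/
theorem rho'_not_classical_quantum :
    ¬ ∃ (ψ₁ ψ₂ : Fin 2 → ℂ) (p₁ p₂ : ℝ) (σ₁ σ₂ : Matrix (Fin 2) (Fin 2) ℂ),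
      (∑ i, star (ψ₁ i) * ψ₁ i = 1) ∧ (∑ i, star (ψ₂ i) * ψ₂ i = 1) ∧
      (∑ i, star (ψ₁ i) * ψ₂ i = 0) ∧
      0 ≤ p₁ ∧ 0 ≤ p₂ ∧ p₁ + p₂ = 1 ∧
      σ₁.PosSemidef ∧ Matrix.trace σ₁ = 1 ∧
      σ₂.PosSemidef ∧ Matrix.trace σ₂ = 1 ∧
      ρ' = (p₁ : ℂ) • (proj ψ₁ ⊗ₖ σ₁) + (p₂ : ℂ) • (proj ψ₂ ⊗ₖ σ₂) := by
  rintro ⟨ψ₁, ψ₂, p₁, p₂, σ₁, σ₂, -, -, horth, -, -, -, -, -, -, -, hρ⟩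
  apply not_commute_diagBlock_ρ'
  rw [hρ, diagBlock_add_smul_kronecker, diagBlock_add_smul_kronecker]
  exact commute_proj_combination horth _ _ _ _

end
end
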